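/- arXiv:1609.04498 — 2 statements merged into one kernel-verified Lean document; each statement's English description precedes it below -/
import Mathlib

section
/- Let (A,Ω) be a relative fractal drum in ℝ^N with |Ω| > 0 and D̄ := dim̄_B(A,Ω) < N. Then: (a) for every s ∈ ℂ with D̄ < Re s < N the integral ∫_0^{+∞} t^{Re s − N − 1}|A_t ∩ Ω| dt is finite, and the Mellin zeta function ζ^𝔐_{A,Ω} is holomorphic on the open strip {D̄ < Re s < N} with derivative (ζ^𝔐_{A,Ω})'(s) = ∫_0^{+∞} t^{s−N−1}|A_t ∩ Ω|·log t dt; (b) for every real σ with σ < D̄ or σ ≥ N, ∫_0^{+∞} t^{σ−N−1}|A_t ∩ Ω| dt = +∞; (c) for every δ > 0 with Ω ⊆ A_δ and every s with D̄ < Re s < N one has ζ^𝔐_{A,Ω}(s) = ζ̃_{A,Ω}(s;δ) + δ^{s−N}|Ω|/(N−s) and (N−s)·ζ^𝔐_{A,Ω}(s) = ∫_Ω dist(x,A)^{s−N} dx. -/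
open MeasureTheory Filter Complex Set Metric Topology Asymptotics
open scoped ENNReal NNReal

noncomputable section

/-- The open `t`-neighborhood `A_t = {x : dist(x,A) < t}` of a set `A ⊆ ℝ^N`. -/
def nbhd (N : ℕ) (A : Set (EuclideanSpace ℝ (Fin N))) (t : ℝ) :
    Set (EuclideanSpace ℝ (Fin N)) :=
  {x | Metric.infDist x A < t}

/-- The volume `|A_t ∩ Ω|` of the `t`-neighborhood of `A` relative to `Ω`. -/
def tubeVol (N : ℕ) (A Ω : Set (EuclideanSpace ℝ (Fin N))) (t : ℝ) : ℝ :=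
  (volume (nbhd N A t ∩ Ω)).toReal

/-- The upper `r`-dimensional Minkowski content of the relative fractal drum `(A,Ω)`. -/
def upperContent (N : ℕ) (A Ω : Set (EuclideanSpace ℝ (Fin N))) (r : ℝ) : ℝ≥0∞ :=
  Filter.limsup
    (fun t : ℝ => volume (nbhd N A t ∩ Ω) / ENNReal.ofReal (t ^ ((N : ℝ) - r)))
    (nhdsWithin 0 (Set.Ioi 0))

/-- The lower `r`-dimensional Minkowski content of the relative fractal drum `(A,Ω)`. -/
def lowerContent (N : ℕ) (A Ω : Set (EuclideanSpace ℝ (Fin N))) (r : ℝ) : ℝ≥0∞ :=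
  Filter.liminf
    (fun t : ℝ => volume (nbhd N A t ∩ Ω) / ENNReal.ofReal (t ^ ((N : ℝ) - r)))
    (nhdsWithin 0 (Set.Ioi 0))

/-- `D` is the (finite) upper box (Minkowski) dimension of `(A,Ω)`:
the greatest lower bound of `{r : M^{*r}(A,Ω) = 0}`. -/
def IsUpperMinkDim (N : ℕ) (A Ω : Set (EuclideanSpace ℝ (Fin N))) (D : ℝ) : Prop :=
  IsGLB {r : ℝ | upperContent N A Ω r = 0} D

/-- `D` is the (finite) lower box (Minkowski) dimension of `(A,Ω)`. -/
def IsLowerMinkDim (N : ℕ) (A Ω : Set (EuclideanSpace ℝ (Fin N))) (D : ℝ) : Prop :=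
  IsGLB {r : ℝ | lowerContent N A Ω r = 0} D

/-- The box (Minkowski) dimension of `(A,Ω)` exists and equals `D`. -/
def IsMinkDim (N : ℕ) (A Ω : Set (EuclideanSpace ℝ (Fin N))) (D : ℝ) : Prop :=
  IsUpperMinkDim N A Ω D ∧ IsLowerMinkDim N A Ω D

/-- `(A,Ω)` is a relative fractal drum in `ℝ^N`. -/
def IsRFD (N : ℕ) (A Ω : Set (EuclideanSpace ℝ (Fin N))) : Prop :=
  A.Nonempty ∧ MeasurableSet Ω ∧ volume Ω < ⊤ ∧ ∃ δ₀ > (0 : ℝ), Ω ⊆ nbhd N A δ₀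

/-- The relative distance zeta function `ζ_{A,Ω}(s) = ∫_Ω d(x,A)^{s-N} dx`. -/
def distZeta (N : ℕ) (A Ω : Set (EuclideanSpace ℝ (Fin N))) (s : ℂ) : ℂ :=
  ∫ x in Ω, (Metric.infDist x A : ℂ) ^ (s - (N : ℂ))

/-- The relative distance zeta function with parameter `δ`:
`ζ_{A,Ω}(s;δ) = ∫_{A_δ ∩ Ω} d(x,A)^{s-N} dx`. -/
def distZetaD (N : ℕ) (A Ω : Set (EuclideanSpace ℝ (Fin N))) (δ : ℝ) (s : ℂ) : ℂ :=
  ∫ x in nbhd N A δ ∩ Ω, (Metric.infDist x A : ℂ) ^ (s - (N : ℂ))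

/-- The relative tube zeta function `ζ̃_{A,Ω}(s;δ) = ∫_0^δ t^{s-N-1}|A_t ∩ Ω| dt`. -/
def tubeZeta (N : ℕ) (A Ω : Set (EuclideanSpace ℝ (Fin N))) (δ : ℝ) (s : ℂ) : ℂ :=
  ∫ t in Set.Ioc (0 : ℝ) δ, (t : ℂ) ^ (s - (N : ℂ) - 1) * ((tubeVol N A Ω t : ℝ) : ℂ)

/-- The Mellin zeta function `ζ^𝔐_{A,Ω}(s) = ∫_0^∞ t^{s-N-1}|A_t ∩ Ω| dt`. -/
def mellinZeta (N : ℕ) (A Ω : Set (EuclideanSpace ℝ (Fin N))) (s : ℂ) : ℂ :=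
  ∫ t in Set.Ioi (0 : ℝ), (t : ℂ) ^ (s - (N : ℂ) - 1) * ((tubeVol N A Ω t : ℝ) : ℂ)

/-- `(A,Ω)` is Minkowski measurable with dimension `D` and Minkowski content `M`. -/
def MinkMeasurable (N : ℕ) (A Ω : Set (EuclideanSpace ℝ (Fin N))) (D M : ℝ) : Prop :=
  0 < M ∧
    Tendsto (fun t : ℝ => tubeVol N A Ω t / t ^ ((N : ℝ) - D))
      (nhdsWithin 0 (Set.Ioi 0)) (nhds M)

/-- `ω` is a pole of `F` (the norm of `F` blows up at `ω`). -/
def IsPoleAt (F : ℂ → ℂ) (ω : ℂ) : Prop :=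
  Tendsto (fun s => ‖F s‖) (nhdsWithin ω {ω}ᶜ) atTop

/-- The languidity conditions **L1**–**L2** for `F` with screen `S`, exponent `κ`,
constants `c`, `C` and two-sided sequence `T`. -/
def LanguidWith (F : ℂ → ℂ) (S : ℝ → ℝ) (κ c C : ℝ) (T : ℤ → ℝ) : Prop :=
  0 < C ∧
  (∀ n : ℤ, 1 ≤ n → T (-n) < 0 ∧ 0 < T n) ∧
  Tendsto (fun n : ℕ => T (n : ℤ)) atTop atTop ∧
  Tendsto (fun n : ℕ => T (-(n : ℤ))) atTop atBot ∧
  (∀ n : ℤ, ∀ σ : ℝ, S (T n) < σ → σ < c →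
    ‖F ((σ : ℂ) + (T n : ℝ) * Complex.I)‖ ≤ C * (|T n| + 1) ^ κ) ∧
  (∀ τ : ℝ, 1 ≤ |τ| → ‖F ((S τ : ℂ) + (τ : ℝ) * Complex.I)‖ ≤ C * |τ| ^ κ)

/-- `S` is a screen (for upper box dimension `D`): a Lipschitz function bounded below,
with `sup S ≤ D`. -/
def IsScreen (S : ℝ → ℝ) (D : ℝ) : Prop :=
  (∃ K : NNReal, LipschitzWith K S) ∧ BddBelow (Set.range S) ∧ ∀ τ : ℝ, S τ ≤ D

/-- The window associated with the screen `S`. -/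
def window (S : ℝ → ℝ) : Set ℂ :=
  {s : ℂ | S s.im ≤ s.re}


section TubeFunction

variable {N : ℕ} {A Ω : Set (EuclideanSpace ℝ (Fin N))}

theorem measurableSet_nbhd (t : ℝ) : MeasurableSet (nbhd N A t) :=
  (continuous_infDist_pt A).measurable measurableSet_Iio

theorem nbhd_mono {t u : ℝ} (h : t ≤ u) : nbhd N A t ⊆ nbhd N A u :=
  fun _ hx => lt_of_lt_of_le hx h

theorem tubeVol_nonneg (t : ℝ) : 0 ≤ tubeVol N A Ω t := ENNReal.toReal_nonneg

theorem volume_nbhd_inter_ne_top (hΩ : volume Ω < ⊤) (t : ℝ) :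
    volume (nbhd N A t ∩ Ω) ≠ ⊤ :=
  ((measure_mono inter_subset_right).trans_lt hΩ).ne

theorem tubeVol_mono (hΩ : volume Ω < ⊤) : Monotone (tubeVol N A Ω) := fun _ u h =>
  ENNReal.toReal_mono (volume_nbhd_inter_ne_top hΩ u)
    (measure_mono (inter_subset_inter_left _ (nbhd_mono h)))

theorem tubeVol_eq_of_subset {δ t : ℝ} (h : Ω ⊆ nbhd N A δ) (ht : δ ≤ t) :
    tubeVol N A Ω t = (volume Ω).toReal := by
  rw [tubeVol, inter_eq_self_of_subset_right (h.trans (nbhd_mono ht))]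

theorem tubeVol_isBigO_nhdsGT_zero {r : ℝ} (hr : upperContent N A Ω r = 0) :
    tubeVol N A Ω =O[𝓝[>] 0] (fun t : ℝ => t ^ ((N : ℝ) - r)) := by
  have h1 : upperContent N A Ω r < 1 := by rw [hr]; exact zero_lt_one
  refine IsBigO.of_bound 1 ?_
  filter_upwards [eventually_lt_of_limsup_lt h1, self_mem_nhdsWithin] with t ht ht0
  have hp : 0 < t ^ ((N : ℝ) - r) := Real.rpow_pos_of_pos ht0 _
  rw [ENNReal.div_lt_iff (.inl (by simpa using hp)) (.inl ENNReal.ofReal_ne_top), one_mul] at ht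
  rw [Real.norm_of_nonneg (tubeVol_nonneg t), Real.norm_of_nonneg hp.le, one_mul]
  exact ENNReal.toReal_le_of_le_ofReal hp.le ht.le

theorem tubeVol_isBigO_atTop {δ : ℝ} (h : Ω ⊆ nbhd N A δ) :
    tubeVol N A Ω =O[atTop] (fun t : ℝ => t ^ (-(0 : ℝ))) := by
  refine IsBigO.of_bound (volume Ω).toReal ?_
  filter_upwards [eventually_ge_atTop δ] with t ht
  rw [tubeVol_eq_of_subset h ht]
  simp

theorem upperContent_eq_zero_of_le_rpow (hΩ : volume Ω < ⊤) {C σ r : ℝ} (hr : σ < r)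
    (h : ∀ t : ℝ, 0 < t → tubeVol N A Ω t ≤ C * t ^ ((N : ℝ) - σ)) : upperContent N A Ω r = 0 := by
  refine Tendsto.limsup_eq ?_
  have hlim : Tendsto (fun t : ℝ => ENNReal.ofReal (C * t ^ (r - σ))) (𝓝[>] 0) (𝓝 0) := by
    have h0 : Tendsto (fun t : ℝ => C * t ^ (r - σ)) (𝓝 0) (𝓝 (C * 0 ^ (r - σ))) :=
      ((Real.continuousAt_rpow_const _ _ (.inr (sub_pos.2 hr).le)).tendsto).const_mul C
    rw [Real.zero_rpow (sub_pos.2 hr).ne', mul_zero] at h0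
    simpa using ENNReal.tendsto_ofReal (h0.mono_left nhdsWithin_le_nhds)
  refine tendsto_of_tendsto_of_tendsto_of_le_of_le' tendsto_const_nhds hlim
    (Eventually.of_forall fun _ => zero_le) ?_
  filter_upwards [self_mem_nhdsWithin] with t ht0
  have hp : 0 < t ^ ((N : ℝ) - r) := Real.rpow_pos_of_pos ht0 _
  rw [ENNReal.div_le_iff (by simpa using hp) ENNReal.ofReal_ne_top,
    ← ENNReal.ofReal_mul' hp.le, ENNReal.le_ofReal_iff_toReal_le (volume_nbhd_inter_ne_top hΩ t)]
  · have : C * t ^ (r - σ) * t ^ ((N : ℝ) - r) = C * t ^ ((N : ℝ) - σ) := by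
      rw [mul_assoc, ← Real.rpow_add ht0]
      congr 2
      ring
    rw [this]
    exact h t ht0
  · have := (tubeVol_nonneg t).trans (h t ht0)
    have hC : 0 ≤ C := nonneg_of_mul_nonneg_left this (Real.rpow_pos_of_pos ht0 _)
    have : 0 < t ^ (r - σ) := Real.rpow_pos_of_pos ht0 _
    positivity

theorem tubeVol_le_of_lintegral_ne_top (hΩ : volume Ω < ⊤) {σ : ℝ} (hσ : σ < N)
    (h : ∫⁻ t in Ioi (0 : ℝ), ENNReal.ofReal (t ^ (σ - (N : ℝ) - 1) * tubeVol N A Ω t) ≠ ⊤) :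
    ∃ C : ℝ, ∀ t : ℝ, 0 < t → tubeVol N A Ω t ≤ C * t ^ ((N : ℝ) - σ) := by
  set I := ∫⁻ t in Ioi (0 : ℝ), ENNReal.ofReal (t ^ (σ - (N : ℝ) - 1) * tubeVol N A Ω t)
  refine ⟨I.toReal / 2 ^ (σ - (N : ℝ) - 1), fun t ht => ?_⟩
  have h2t : 0 < 2 * t := by positivity
  have hle : ENNReal.ofReal ((2 * t) ^ (σ - (N : ℝ) - 1) * tubeVol N A Ω t * t) ≤ I := by
    calc ENNReal.ofReal ((2 * t) ^ (σ - (N : ℝ) - 1) * tubeVol N A Ω t * t)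
        = ∫⁻ _ in Ioc t (2 * t),
            ENNReal.ofReal ((2 * t) ^ (σ - (N : ℝ) - 1) * tubeVol N A Ω t) := by
          rw [setLIntegral_const, Real.volume_Ioc, ← ENNReal.ofReal_mul]
          · congr 1
            ring
          · exact mul_nonneg (Real.rpow_nonneg h2t.le _) (tubeVol_nonneg t)
      _ ≤ ∫⁻ u in Ioc t (2 * t), ENNReal.ofReal (u ^ (σ - (N : ℝ) - 1) * tubeVol N A Ω u) := by
          refine setLIntegral_mono' measurableSet_Ioc fun u hu => ENNReal.ofReal_le_ofReal ?_
          exact mul_le_mul (Real.rpow_le_rpow_of_nonpos (ht.trans hu.1) hu.2 (by linarith))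
            (tubeVol_mono hΩ hu.1.le) (tubeVol_nonneg t) (Real.rpow_nonneg (ht.trans hu.1).le _)
      _ ≤ I := lintegral_mono_set fun u hu => ht.trans hu.1
  have hle' := (ENNReal.ofReal_le_iff_le_toReal h).1 hle
  rw [Real.mul_rpow zero_le_two ht.le] at hle'
  have hp2 : (0 : ℝ) < 2 ^ (σ - (N : ℝ) - 1) := Real.rpow_pos_of_pos two_pos _
  have hpt : t ^ (σ - (N : ℝ) - 1) * t * t ^ ((N : ℝ) - σ) = 1 := by
    rw [← Real.rpow_add_one ht.ne', ← Real.rpow_add ht]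
    ring_nf
    exact Real.rpow_zero t
  rw [div_mul_eq_mul_div, le_div_iff₀ hp2]
  calc tubeVol N A Ω t * 2 ^ (σ - (N : ℝ) - 1)
      = 2 ^ (σ - (N : ℝ) - 1) * t ^ (σ - (N : ℝ) - 1) * tubeVol N A Ω t * t
          * t ^ ((N : ℝ) - σ) := by
        linear_combination (-(tubeVol N A Ω t * 2 ^ (σ - (N : ℝ) - 1))) * hpt
    _ ≤ I.toReal * t ^ ((N : ℝ) - σ) :=
        mul_le_mul_of_nonneg_right hle' (Real.rpow_nonneg ht.le _)

theorem lintegral_tubeVol_eq_top_of_lt_dim (hΩ : volume Ω < ⊤) {D σ : ℝ}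
    (hD : IsUpperMinkDim N A Ω D) (hDN : D < N) (hσ : σ < D) :
    ∫⁻ t in Ioi (0 : ℝ), ENNReal.ofReal (t ^ (σ - (N : ℝ) - 1) * tubeVol N A Ω t) = ⊤ := by
  by_contra h
  obtain ⟨C, hC⟩ := tubeVol_le_of_lintegral_ne_top hΩ (hσ.trans hDN) h
  obtain ⟨r, hσr, hrD⟩ := exists_between hσ
  exact hrD.not_ge (hD.1 (upperContent_eq_zero_of_le_rpow hΩ hσr hC))

theorem lintegral_tubeVol_eq_top_of_ge (hΩ : volume Ω < ⊤) (hΩpos : 0 < volume Ω) {δ σ : ℝ}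
    (hδ : 0 < δ) (hsub : Ω ⊆ nbhd N A δ) (hσ : (N : ℝ) ≤ σ) :
    ∫⁻ t in Ioi (0 : ℝ), ENNReal.ofReal (t ^ (σ - (N : ℝ) - 1) * tubeVol N A Ω t) = ⊤ := by
  by_contra h
  have hpos : ∀ᵐ t ∂volume.restrict (Ioi (0 : ℝ)),
      0 ≤ t ^ (σ - (N : ℝ) - 1) * tubeVol N A Ω t := by
    filter_upwards [ae_restrict_mem measurableSet_Ioi] with t ht
    exact mul_nonneg (Real.rpow_nonneg (le_of_lt ht) _) (tubeVol_nonneg t)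
  have hmeas : AEStronglyMeasurable (fun t : ℝ => t ^ (σ - (N : ℝ) - 1) * tubeVol N A Ω t)
      (volume.restrict (Ioi (0 : ℝ))) :=
    ((measurable_id.pow_const _).mul (tubeVol_mono hΩ).measurable).aestronglyMeasurable
  have hint : IntegrableOn (fun t : ℝ => t ^ (σ - (N : ℝ) - 1) * tubeVol N A Ω t) (Ioi δ) :=
    IntegrableOn.mono_set ((lintegral_ofReal_ne_top_iff_integrable hmeas hpos).1 h)
      (Ioi_subset_Ioi hδ.le)
  have hV : (volume Ω).toReal ≠ 0 := (ENNReal.toReal_pos hΩpos.ne' hΩ.ne).ne'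
  have hint' : IntegrableOn (fun t : ℝ => t ^ (σ - (N : ℝ) - 1)) (Ioi δ) := by
    refine IntegrableOn.congr_fun (hint.div_const (volume Ω).toReal) (fun t ht => ?_)
      measurableSet_Ioi
    rw [tubeVol_eq_of_subset hsub (le_of_lt ht), mul_div_cancel_right₀ _ hV]
  rw [integrableOn_Ioi_rpow_iff hδ] at hint'
  linarith

theorem locallyIntegrableOn_tubeVol (hΩ : volume Ω < ⊤) (s : Set ℝ) :
    LocallyIntegrableOn (fun t => (tubeVol N A Ω t : ℂ)) s :=
  fun x _ =>
    have ⟨u, hu, hint⟩ := (tubeVol_mono (N := N) (A := A) hΩ).locallyIntegrable (μ := volume) x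
    ⟨u, nhdsWithin_le_nhds hu, hint.ofReal⟩

theorem exists_upperContent_eq_zero_lt {D σ : ℝ} (hD : IsUpperMinkDim N A Ω D) (hσ : D < σ) :
    ∃ r < σ, upperContent N A Ω r = 0 := by
  obtain ⟨r, hr, -, hlt⟩ := hD.exists_between hσ
  exact ⟨r, hlt, hr⟩

theorem mellinConvergent_tubeVol (hRFD : IsRFD N A Ω) {D : ℝ} (hD : IsUpperMinkDim N A Ω D)
    {s : ℂ} (hs : D < s.re) (hsN : s.re < N) :
    MellinConvergent (fun t => (tubeVol N A Ω t : ℂ)) (s - N) := by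
  obtain ⟨-, -, hΩ, δ, -, hsub⟩ := hRFD
  obtain ⟨r, hrs, hr⟩ := exists_upperContent_eq_zero_lt hD hs
  refine mellinConvergent_of_isBigO_rpow (a := 0) (b := r - N) (locallyIntegrableOn_tubeVol hΩ _)
    (isBigO_ofReal_left.2 (tubeVol_isBigO_atTop hsub)) (by simpa using hsN)
    (isBigO_ofReal_left.2 ?_) (by simpa using hrs)
  simpa using tubeVol_isBigO_nhdsGT_zero hr

theorem hasDerivAt_mellinZeta (hRFD : IsRFD N A Ω) {D : ℝ} (hD : IsUpperMinkDim N A Ω D)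
    {s : ℂ} (hs : D < s.re) (hsN : s.re < N) :
    HasDerivAt (mellinZeta N A Ω)
      (∫ t in Ioi (0 : ℝ),
        (t : ℂ) ^ (s - (N : ℂ) - 1) * ((tubeVol N A Ω t : ℝ) : ℂ) * (Real.log t : ℂ)) s := by
  obtain ⟨-, -, hΩ, δ, -, hsub⟩ := hRFD
  obtain ⟨r, hrs, hr⟩ := exists_upperContent_eq_zero_lt hD hs
  have hbot : (fun t => (tubeVol N A Ω t : ℂ)) =O[𝓝[>] 0] (fun t : ℝ => t ^ (-(r - (N : ℝ)))) :=
    isBigO_ofReal_left.2 (by simpa using tubeVol_isBigO_nhdsGT_zero hr)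
  have h := (mellin_hasDerivAt_of_isBigO_rpow (s := s - N) (a := 0)
    (locallyIntegrableOn_tubeVol hΩ _) (isBigO_ofReal_left.2 (tubeVol_isBigO_atTop hsub))
    (by simpa using hsN) hbot (by simpa using hrs)).2
  refine (h.comp_sub_const s (N : ℂ)).congr_deriv ?_
  refine integral_congr_ae (Eventually.of_forall fun t => ?_)
  simp only [real_smul, smul_eq_mul]
  ring

theorem integrableOn_rpow_mul_tubeVol (hRFD : IsRFD N A Ω) {D : ℝ}
    (hD : IsUpperMinkDim N A Ω D) {s : ℂ} (hs : D < s.re) (hsN : s.re < N) :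
    IntegrableOn (fun t : ℝ => t ^ (s.re - (N : ℝ) - 1) * tubeVol N A Ω t) (Ioi (0 : ℝ)) := by
  refine IntegrableOn.congr_fun (mellinConvergent_tubeVol hRFD hD hs hsN).norm (fun t ht => ?_)
    measurableSet_Ioi
  simp [norm_cpow_eq_rpow_re_of_pos ht, abs_of_nonneg (tubeVol_nonneg _)]

theorem mellinZeta_eq_tubeZeta_add (hRFD : IsRFD N A Ω) {D : ℝ}
    (hD : IsUpperMinkDim N A Ω D) {δ : ℝ} (hδ : 0 < δ) (hsub : Ω ⊆ nbhd N A δ)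
    {s : ℂ} (hs : D < s.re) (hsN : s.re < N) :
    mellinZeta N A Ω s = tubeZeta N A Ω δ s
      + (δ : ℂ) ^ (s - (N : ℂ)) * (((volume Ω).toReal : ℝ) : ℂ) / ((N : ℂ) - s) := by
  have hint : IntegrableOn
      (fun t : ℝ => (t : ℂ) ^ (s - (N : ℂ) - 1) * ((tubeVol N A Ω t : ℝ) : ℂ)) (Ioi 0) :=
    mellinConvergent_tubeVol hRFD hD hs hsN
  rw [mellinZeta, tubeZeta, ← Ioc_union_Ioi_eq_Ioi hδ.le,
    setIntegral_union Ioc_disjoint_Ioi_same measurableSet_Ioi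
      (hint.mono_set Ioc_subset_Ioi_self) (hint.mono_set (Ioi_subset_Ioi hδ.le))]
  congr 1
  have hcongr : ∫ t in Ioi δ, (t : ℂ) ^ (s - (N : ℂ) - 1) * ((tubeVol N A Ω t : ℝ) : ℂ)
      = ∫ t in Ioi δ, (t : ℂ) ^ (s - (N : ℂ) - 1) * (((volume Ω).toReal : ℝ) : ℂ) :=
    setIntegral_congr_fun measurableSet_Ioi fun t ht => by
      simp only [tubeVol_eq_of_subset hsub (le_of_lt ht)]
  rw [hcongr, integral_mul_const, integral_Ioi_cpow_of_lt (by simp; linarith) hδ,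
    sub_add_cancel, ← neg_sub (N : ℂ) s, neg_div_neg_eq, div_mul_eq_mul_div]

theorem ae_infDist_pos (hRFD : IsRFD N A Ω) {D : ℝ}
    (hD : IsUpperMinkDim N A Ω D) (hDN : D < N) :
    ∀ᵐ x ∂volume.restrict Ω, 0 < infDist x A := by
  obtain ⟨-, hΩm, hΩ, -⟩ := hRFD
  obtain ⟨r, hrN, hr⟩ := exists_upperContent_eq_zero_lt hD hDN
  have hlim : Tendsto (tubeVol N A Ω) (𝓝[>] 0) (𝓝 0) := by
    refine (tubeVol_isBigO_nhdsGT_zero hr).trans_tendsto ?_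
    have h0 := (Real.continuousAt_rpow_const 0 ((N : ℝ) - r) (.inr (sub_pos.2 hrN).le)).tendsto
    rw [Real.zero_rpow (sub_pos.2 hrN).ne'] at h0
    exact h0.mono_left nhdsWithin_le_nhds
  have hle : volume.real ({x | ¬ 0 < infDist x A} ∩ Ω) ≤ 0 := by
    refine ge_of_tendsto hlim ?_
    filter_upwards [self_mem_nhdsWithin] with t ht
    refine ENNReal.toReal_mono (volume_nbhd_inter_ne_top hΩ t)
      (measure_mono (inter_subset_inter_left _ fun x hx => ?_))
    exact (not_lt.1 hx).trans_lt ht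
  rw [ae_iff, Measure.restrict_apply' hΩm]
  exact (measureReal_eq_zero_iff ((measure_mono inter_subset_right).trans_lt hΩ).ne).1
    (le_antisymm hle measureReal_nonneg)

theorem mul_mellinZeta_eq_distZeta (hRFD : IsRFD N A Ω) {D : ℝ}
    (hD : IsUpperMinkDim N A Ω D) (hDN : D < N)
    {s : ℂ} (hs : D < s.re) (hsN : s.re < N) :
    ((N : ℂ) - s) * mellinZeta N A Ω s = distZeta N A Ω s := by
  have hΩm := hRFD.2.1
  have hΩ := hRFD.2.2.1
  have : IsFiniteMeasure (volume.restrict Ω) := ⟨by simpa using hΩ⟩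
  let F : ℝ → EuclideanSpace ℝ (Fin N) → ℂ := fun t x =>
    (nbhd N A t).indicator (fun _ => (t : ℂ) ^ (s - (N : ℂ) - 1)) x
  have hinner : ∀ c : ℂ, ∀ t : ℝ, ∫ x in Ω, (nbhd N A t).indicator (fun _ => c) x
      = c * ((tubeVol N A Ω t : ℝ) : ℂ) := fun c t => by
    rw [integral_indicator_const _ (measurableSet_nbhd t), Measure.real,
      Measure.restrict_apply (measurableSet_nbhd t), real_smul, mul_comm, tubeVol]
  have hset : MeasurableSet {p : ℝ × EuclideanSpace ℝ (Fin N) | infDist p.2 A < p.1} :=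
    measurableSet_lt ((continuous_infDist_pt A).measurable.comp measurable_snd) measurable_fst
  have hFm : Measurable (Function.uncurry F) := by
    have : Function.uncurry F = {p : ℝ × EuclideanSpace ℝ (Fin N) | infDist p.2 A < p.1}.indicator
        (fun p => (p.1 : ℂ) ^ (s - (N : ℂ) - 1)) := rfl
    rw [this]
    exact Measurable.indicator (by fun_prop) hset
  have hFint : Integrable (Function.uncurry F)
      ((volume.restrict (Ioi (0 : ℝ))).prod (volume.restrict Ω)) := by
    rw [integrable_prod_iff hFm.aestronglyMeasurable]
    refine ⟨Eventually.of_forall fun t => ?_, ?_⟩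
    · exact (integrable_const ((t : ℂ) ^ (s - (N : ℂ) - 1))).indicator (measurableSet_nbhd t)
    · refine (mellinConvergent_tubeVol hRFD hD hs hsN).norm.congr (Eventually.of_forall fun t => ?_)
      simp only [Function.uncurry_apply_pair, F, norm_indicator_eq_indicator_norm]
      rw [integral_indicator_const _ (measurableSet_nbhd t), Measure.real,
        Measure.restrict_apply (measurableSet_nbhd t), norm_smul, norm_real,
        Real.norm_of_nonneg (tubeVol_nonneg t), smul_eq_mul, mul_comm, tubeVol]
  have hswap := integral_integral_swap hFint
  have hmellin : mellinZeta N A Ω s = ∫ t in Ioi (0 : ℝ), ∫ x in Ω, F t x := by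
    simp only [F, hinner, mellinZeta]
  have hne : (N : ℂ) - s ≠ 0 := fun h => by
    have := congrArg re h
    simp at this
    linarith
  rw [hmellin, hswap, distZeta, ← integral_const_mul]
  refine integral_congr_ae ?_
  filter_upwards [ae_infDist_pos hRFD hD hDN] with x hx
  have hF : ∀ t, F t x = (Ioi (infDist x A)).indicator
      (fun t : ℝ => (t : ℂ) ^ (s - (N : ℂ) - 1)) t := fun t => rfl
  simp only [hF]
  rw [setIntegral_indicator measurableSet_Ioi,
    inter_eq_self_of_subset_right (Ioi_subset_Ioi hx.le),
    integral_Ioi_cpow_of_lt (by simp; linarith) hx,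
    sub_add_cancel, ← neg_sub (N : ℂ) s, neg_div_neg_eq, mul_div_cancel₀ _ hne]

end TubeFunction

/-- basic properties of the Mellin zeta function.
Let `(A,Ω)` be an RFD in `ℝ^N` with `|Ω| > 0` and `D̄ := dim̄_B(A,Ω) < N`.  Then:
(a) for `D̄ < Re s < N` the integral `∫_0^∞ t^{Re s − N − 1}|A_t ∩ Ω| dt` is finite, and
`ζ^𝔐_{A,Ω}` is holomorphic on the open strip `{D̄ < Re s < N}` with derivative
`∫_0^∞ t^{s−N−1}|A_t ∩ Ω| log t dt`;
(b) for every real `σ` with `σ < D̄` or `σ ≥ N`, the integral diverges to `+∞`;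
(c) for every `δ > 0` with `Ω ⊆ A_δ` and every `s` in the strip,
`ζ^𝔐_{A,Ω}(s) = ζ̃_{A,Ω}(s;δ) + δ^{s−N}|Ω|/(N−s)` and
`(N−s)·ζ^𝔐_{A,Ω}(s) = ζ_{A,Ω}(s)`. -/
theorem statement13
    (N : ℕ) (A Ω : Set (EuclideanSpace ℝ (Fin N))) (Dbar : ℝ)
    (hRFD : IsRFD N A Ω) (hΩpos : 0 < volume Ω)
    (hD : IsUpperMinkDim N A Ω Dbar) (hDN : Dbar < N) :
    ((∀ s : ℂ, Dbar < s.re → s.re < N →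
        IntegrableOn (fun t : ℝ => t ^ (s.re - (N : ℝ) - 1) * tubeVol N A Ω t)
          (Set.Ioi (0 : ℝ)) volume) ∧
      DifferentiableOn ℂ (mellinZeta N A Ω) {s : ℂ | Dbar < s.re ∧ s.re < N} ∧
      (∀ s : ℂ, Dbar < s.re → s.re < N →
        HasDerivAt (mellinZeta N A Ω)
          (∫ t in Set.Ioi (0 : ℝ),
            (t : ℂ) ^ (s - (N : ℂ) - 1) * ((tubeVol N A Ω t : ℝ) : ℂ) * (Real.log t : ℂ))
          s)) ∧
    (∀ σ : ℝ, σ < Dbar ∨ (N : ℝ) ≤ σ →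
      ∫⁻ t in Set.Ioi (0 : ℝ),
        ENNReal.ofReal (t ^ (σ - (N : ℝ) - 1) * tubeVol N A Ω t) = ⊤) ∧
    (∀ δ : ℝ, 0 < δ → Ω ⊆ nbhd N A δ →
      ∀ s : ℂ, Dbar < s.re → s.re < N →
        mellinZeta N A Ω s
          = tubeZeta N A Ω δ s
            + (δ : ℂ) ^ (s - (N : ℂ)) * (((volume Ω).toReal : ℝ) : ℂ) / ((N : ℂ) - s) ∧
        ((N : ℂ) - s) * mellinZeta N A Ω s = distZeta N A Ω s) := by
  obtain ⟨-, -, hΩ, δ₀, hδ₀, hsub₀⟩ := id hRFD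
  refine ⟨⟨fun s hs hsN => integrableOn_rpow_mul_tubeVol hRFD hD hs hsN,
    fun s hs => (hasDerivAt_mellinZeta hRFD hD hs.1 hs.2).differentiableAt.differentiableWithinAt,
    fun s hs hsN => hasDerivAt_mellinZeta hRFD hD hs hsN⟩, ?_, fun δ hδ hsub s hs hsN =>
    ⟨mellinZeta_eq_tubeZeta_add hRFD hD hδ hsub hs hsN,
      mul_mellinZeta_eq_distZeta hRFD hD hDN hs hsN⟩⟩
  rintro σ (hσ | hσ)
  · exact lintegral_tubeVol_eq_top_of_lt_dim hΩ hD hDN hσ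
  · exact lintegral_tubeVol_eq_top_of_ge hΩ hΩpos hδ₀ hsub₀ hσ

end
end

section
/- Let (A,Ω) be a relative fractal drum in ℝ^N such that D := dim_B(A,Ω) exists, D < N, and (A,Ω) is Minkowski measurable. Let S be a screen with sup S < D, let U be an open connected neighborhood of the associated window W, and let F be a meromorphic extension of the Mellin zeta function ζ^𝔐_{A,Ω} to U (i.e., F(s) = ζ^𝔐_{A,Ω}(s) for all s ∈ U with D < Re s < N) satisfying the languidity conditions (L1)–(L2) with some exponent κ ∈ ℝ, where the constant c in (L1) is taken in the interval (D, N). Assume that every pole ω of F in U with Re ω < D satisfies Re ω < S(Im ω) (i.e., the screen passes strictly to the right of all poles of F with real part strictly less than D). Then D is the only pole of F on the critical line {Re s = D}, and this pole is simple. -/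
open MeasureTheory Filter Complex Set Metric Topology Asymptotics
open scoped ENNReal NNReal

noncomputable section

/-- The part of a Mellin transform governed by `o(t ^ a)` behaviour at `0` has vanishing
residue on the line `Re s = -a`. -/
theorem tendsto_mul_mellin_of_isLittleO {h : ℝ → ℂ} {a K : ℝ} (ha : 0 < a) (τ : ℝ)
    (hconv : ∀ x : ℝ, 0 < x → x < a → MellinConvergent h ((x : ℂ) - a + τ * I))
    (hb : ∀ t : ℝ, 0 < t → ‖h t‖ ≤ K) (ho : h =o[𝓝[>] 0] fun t : ℝ => t ^ a) :
    Tendsto (fun x : ℝ => (x : ℂ) * mellin h ((x : ℂ) - a + τ * I)) (𝓝[>] 0) (𝓝 0) := by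
  rw [NormedAddGroup.tendsto_nhds_zero]
  intro ε hε
  have h1 := ho.bound (half_pos hε)
  obtain ⟨δ, hδ, hδb⟩ := mem_nhdsGT_iff_exists_Ioc_subset.1 h1
  have hδ0 : (0 : ℝ) < δ := hδ
  have hlim : Tendsto (fun x : ℝ => ε / 2 * δ ^ x + x * (K * (δ ^ (x - a) / (a - x))))
      (𝓝[>] 0) (𝓝 (ε / 2)) := by
    have : ContinuousAt (fun x : ℝ => ε / 2 * δ ^ x + x * (K * (δ ^ (x - a) / (a - x)))) 0 := by
      have c1 : ContinuousAt (fun x : ℝ => δ ^ x) 0 :=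
        (Real.continuous_const_rpow hδ0.ne').continuousAt
      have c2 : ContinuousAt (fun x : ℝ => δ ^ (x - a)) 0 :=
        ((Real.continuous_const_rpow hδ0.ne').comp (continuous_sub_right a)).continuousAt
      have c3 : ContinuousAt (fun x : ℝ => a - x) 0 := by fun_prop
      exact (continuousAt_const.mul c1).add
        (continuousAt_id.mul (continuousAt_const.mul (c2.div c3 (by simpa using ha.ne'))))
    simpa using this.tendsto.mono_left nhdsWithin_le_nhds
  filter_upwards [hlim.eventually_lt_const (half_lt_self hε), Ioo_mem_nhdsGT ha] with x hx hxa
  obtain ⟨hx0, hxa⟩ := hxa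
  have hnorm : ∀ t : ℝ, 0 < t →
      ‖(t : ℂ) ^ ((x : ℂ) - a + τ * I - 1) • h t‖ = t ^ (x - a - 1) * ‖h t‖ := by
    intro t ht
    rw [norm_smul, norm_cpow_eq_rpow_re_of_pos ht]
    simp
  have hsplit : mellin h ((x : ℂ) - a + τ * I) =
      (∫ t in Ioc 0 δ, (t : ℂ) ^ ((x : ℂ) - a + τ * I - 1) • h t) +
      ∫ t in Ioi δ, (t : ℂ) ^ ((x : ℂ) - a + τ * I - 1) • h t := by
    have hc := hconv x hx0 hxa
    rw [mellin, ← Ioc_union_Ioi_eq_Ioi hδ0.le]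
    exact setIntegral_union (Ioc_disjoint_Ioi le_rfl) measurableSet_Ioi
      (hc.mono_set Ioc_subset_Ioi_self) (hc.mono_set (Ioi_subset_Ioi hδ0.le))
  have b1 : ‖∫ t in Ioc 0 δ, (t : ℂ) ^ ((x : ℂ) - a + τ * I - 1) • h t‖ ≤
      ε / 2 * (δ ^ x / x) := by
    have hint : IntegrableOn (fun t : ℝ => ε / 2 * t ^ (x - 1)) (Ioc 0 δ) :=
      ((intervalIntegrable_iff_integrableOn_Ioc_of_le hδ0.le).1
        (intervalIntegral.intervalIntegrable_rpow' (by linarith))).const_mul _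
    refine (norm_integral_le_of_norm_le hint ?_).trans_eq ?_
    · filter_upwards [ae_restrict_mem measurableSet_Ioc] with t ht
      have h2 : ‖h t‖ ≤ ε / 2 * ‖t ^ a‖ := hδb ht
      rw [hnorm t ht.1]
      rw [Real.norm_of_nonneg (Real.rpow_nonneg ht.1.le _)] at h2
      calc t ^ (x - a - 1) * ‖h t‖ ≤ t ^ (x - a - 1) * (ε / 2 * t ^ a) := by
            gcongr; exact Real.rpow_nonneg ht.1.le _
        _ = ε / 2 * (t ^ (x - a - 1) * t ^ a) := by ring
        _ = ε / 2 * t ^ (x - 1) := by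
            rw [← Real.rpow_add ht.1]; congr 2; ring
    · rw [integral_const_mul, ← intervalIntegral.integral_of_le hδ0.le,
        integral_rpow (Or.inl (by linarith))]
      simp [Real.zero_rpow hx0.ne']
  have b2 : ‖∫ t in Ioi δ, (t : ℂ) ^ ((x : ℂ) - a + τ * I - 1) • h t‖ ≤
      K * (δ ^ (x - a) / (a - x)) := by
    have hint : IntegrableOn (fun t : ℝ => K * t ^ (x - a - 1)) (Ioi δ) :=
      (integrableOn_Ioi_rpow_of_lt (by linarith) hδ0).const_mul _
    refine (norm_integral_le_of_norm_le hint ?_).trans_eq ?_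
    · filter_upwards [ae_restrict_mem measurableSet_Ioi] with t ht
      have ht0 : 0 < t := hδ0.trans ht
      rw [hnorm t ht0, mul_comm K]
      exact mul_le_mul_of_nonneg_left (hb t ht0) (Real.rpow_nonneg ht0.le _)
    · rw [integral_const_mul, integral_Ioi_rpow_of_lt (by linarith) hδ0, sub_add_cancel,
        neg_div, ← div_neg, neg_sub]
  calc ‖(x : ℂ) * mellin h ((x : ℂ) - a + τ * I)‖
      = x * ‖mellin h ((x : ℂ) - a + τ * I)‖ := by
        rw [norm_mul, norm_real, Real.norm_of_nonneg hx0.le]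
    _ ≤ x * (ε / 2 * (δ ^ x / x) + K * (δ ^ (x - a) / (a - x))) := by
        rw [hsplit]
        exact mul_le_mul_of_nonneg_left ((norm_add_le _ _).trans (add_le_add b1 b2)) hx0.le
    _ = ε / 2 * δ ^ x + x * (K * (δ ^ (x - a) / (a - x))) := by
        field_simp
    _ < ε := hx

/-- If `f` is bounded and `f t ~ M t ^ a` at `0`, then the Mellin transform of `f` has a simple
pole with residue `M` at `-a` along the horizontal direction, and `o(1 / x)` growth at every
other point of the line `Re s = -a`. -/
theorem tendsto_mul_mellin_of_tendsto_div_rpow {f : ℝ → ℝ} {a K M : ℝ} (ha : 0 < a) (τ : ℝ)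
    (hloc : LocallyIntegrableOn (fun t => (f t : ℂ)) (Ioi 0))
    (hb : ∀ t : ℝ, 0 < t → |f t| ≤ K)
    (hlim : Tendsto (fun t => f t / t ^ a) (𝓝[>] 0) (𝓝 M)) :
    Tendsto (fun x : ℝ => (x : ℂ) * mellin (fun t => (f t : ℂ)) ((x : ℂ) - a + τ * I)) (𝓝[>] 0)
      (𝓝 (if τ = 0 then (M : ℂ) else 0)) := by
  set g : ℝ → ℂ := fun t => (M : ℂ) • indicator (Ioc 0 1) (fun t : ℝ => (t : ℂ) ^ (a : ℂ)) t
  have hfo : (fun t => f t - M * t ^ a) =o[𝓝[>] 0] fun t : ℝ => t ^ a := by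
    rw [isLittleO_iff_tendsto']
    · have := hlim.sub_const M
      rw [sub_self] at this
      refine this.congr' ?_
      filter_upwards [self_mem_nhdsWithin] with t ht
      have : t ^ a ≠ 0 := (Real.rpow_pos_of_pos ht a).ne'
      field_simp
    · filter_upwards [self_mem_nhdsWithin] with t ht h0
      exact absurd h0 (Real.rpow_pos_of_pos ht a).ne'
  have hfO : f =O[𝓝[>] 0] fun t : ℝ => t ^ a := by
    simpa using hfo.isBigO.add ((isBigO_refl (fun t : ℝ => t ^ a) (𝓝[>] 0)).const_mul_left M)
  have hre : ∀ x : ℝ, ((x : ℂ) - a + τ * I).re = x - a := by intro x; simp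
  have hf : ∀ x : ℝ, 0 < x → x < a →
      MellinConvergent (fun t => (f t : ℂ)) ((x : ℂ) - a + τ * I) := by
    intro x hx0 hxa
    refine mellinConvergent_of_isBigO_rpow (a := 0) (b := -a) hloc ?_ ?_ ?_ ?_
    · refine IsBigO.of_bound K ?_
      filter_upwards [eventually_gt_atTop 0] with t ht
      simpa using hb t ht
    · rw [hre]; linarith
    · simpa using isBigO_ofReal_left.2 hfO
    · rw [hre]; linarith
  have hg : ∀ x : ℝ, 0 < x →
      HasMellin g ((x : ℂ) - a + τ * I) ((M : ℂ) * (1 / (x + τ * I))) := by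
    intro x hx0
    have h1 := hasMellin_cpow_Ioc (a : ℂ) (s := (x : ℂ) - a + τ * I)
      (by rw [hre, ofReal_re]; linarith)
    have h2 := hasMellin_const_smul h1.1 (M : ℂ)
    have hs : (x : ℂ) - a + τ * I + a = x + τ * I := by ring
    rw [h1.2, hs] at h2
    exact h2
  have hgt : ∀ t : ℝ, 0 < t → t ≤ 1 → g t = ((M * t ^ a : ℝ) : ℂ) := by
    intro t h0 h1
    have : t ∈ Ioc (0 : ℝ) 1 := ⟨h0, h1⟩
    simp [g, this, ofReal_cpow h0.le]
  have herr : Tendsto (fun x : ℝ => (x : ℂ) *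
      mellin (fun t => (f t : ℂ) - g t) ((x : ℂ) - a + τ * I)) (𝓝[>] 0) (𝓝 0) := by
    refine tendsto_mul_mellin_of_isLittleO (K := K + |M|) ha τ ?_ ?_ ?_
    · intro x hx0 hxa
      exact (hasMellin_sub (hf x hx0 hxa) (hg x hx0).1).1
    · intro t ht
      refine (norm_sub_le _ _).trans (add_le_add (by simpa using hb t ht) ?_)
      rcases le_or_gt t 1 with h1 | h1
      · rw [hgt t ht h1, norm_real, Real.norm_eq_abs, abs_mul,
          abs_of_nonneg (Real.rpow_nonneg ht.le a)]
        exact mul_le_of_le_one_right (abs_nonneg _) (Real.rpow_le_one ht.le h1 ha.le)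
      · simp [g, h1.not_ge]
    · refine (isLittleO_ofReal_left.2 hfo).congr' ?_ EventuallyEq.rfl
      filter_upwards [Ioc_mem_nhdsGT zero_lt_one] with t ht
      rw [hgt t ht.1 ht.2, ofReal_sub]
  have hmain : Tendsto (fun x : ℝ => (x : ℂ) * ((M : ℂ) * (1 / (x + τ * I)))) (𝓝[>] 0)
      (𝓝 (if τ = 0 then (M : ℂ) else 0)) := by
    split_ifs with hτ
    · refine tendsto_const_nhds.congr' ?_
      filter_upwards [self_mem_nhdsWithin] with x hx
      have : (x : ℂ) ≠ 0 := ofReal_ne_zero.2 (ne_of_gt hx)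
      subst hτ
      simp only [ofReal_zero, zero_mul, add_zero]
      field_simp
    · have hc : ContinuousAt (fun x : ℝ => (x : ℂ) * ((M : ℂ) * (1 / (x + τ * I)))) 0 := by
        have : ((0 : ℝ) : ℂ) + τ * I ≠ 0 := by simpa using hτ
        fun_prop (disch := assumption)
      simpa using hc.tendsto.mono_left nhdsWithin_le_nhds
  have := hmain.add herr
  rw [add_zero] at this
  refine this.congr' ?_
  filter_upwards [Ioo_mem_nhdsGT ha] with x hx
  rw [(hasMellin_sub (hf x hx.1 hx.2) (hg x hx.1).1).2, (hg x hx.1).2]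
  ring

/-- A meromorphic function with a limit along a filter finer than the punctured neighborhood
filter has that limit along the full punctured neighborhood filter. -/
theorem MeromorphicAt.tendsto_of_tendsto {g : ℂ → ℂ} {ω L : ℂ} (hg : MeromorphicAt g ω)
    {l : Filter ℂ} [l.NeBot] (hl : l ≤ 𝓝[≠] ω) (h : Tendsto g l (𝓝 L)) :
    Tendsto g (𝓝[≠] ω) (𝓝 L) := by
  rcases lt_or_ge (meromorphicOrderAt g ω) 0 with ho | ho
  · exact absurd h (((tendsto_cobounded_of_meromorphicOrderAt_neg ho).mono_left
      hl).not_tendsto (Metric.disjoint_cobounded_nhds L))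
  · obtain ⟨c, hc⟩ := tendsto_nhds_of_meromorphicOrderAt_nonneg hg ho
    exact tendsto_nhds_unique (hc.mono_left hl) h ▸ hc

/-- A meromorphic function with `(s - ω) F(s) → 0` at `ω` has no pole there. -/
theorem not_isPoleAt_of_tendsto_zero {F : ℂ → ℂ} {ω : ℂ} (hF : MeromorphicAt F ω)
    (h : Tendsto (fun s => (s - ω) * F s) (𝓝[≠] ω) (𝓝 0)) : ¬ IsPoleAt F ω := by
  intro hp
  have hneg : meromorphicOrderAt F ω < 0 :=
    (tendsto_cobounded_iff_meromorphicOrderAt_neg hF).1 (tendsto_norm_atTop_iff_cobounded.1 hp)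
  have hsub : MeromorphicAt (· - ω) ω := by fun_prop
  have hpos : 0 < meromorphicOrderAt ((· - ω) * F) ω :=
    (tendsto_zero_iff_meromorphicOrderAt_pos (hsub.mul hF)).1 h
  rw [meromorphicOrderAt_mul hsub hF, meromorphicOrderAt_id_sub_const] at hpos
  lift meromorphicOrderAt F ω to ℤ using hneg.ne_top with n
  norm_cast at hneg hpos
  omega

theorem tubeVol_le {N : ℕ} {A Ω : Set (EuclideanSpace ℝ (Fin N))} (hΩ : volume Ω < ⊤) (t : ℝ) :
    tubeVol N A Ω t ≤ (volume Ω).toReal :=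
  ENNReal.toReal_mono hΩ.ne (measure_mono inter_subset_right)

theorem monotone_tubeVol {N : ℕ} {A Ω : Set (EuclideanSpace ℝ (Fin N))} (hΩ : volume Ω < ⊤) :
    Monotone (tubeVol N A Ω) := fun _ _ hst =>
  ENNReal.toReal_mono ((measure_mono inter_subset_right).trans_lt hΩ).ne
    (measure_mono (inter_subset_inter_left _ fun _ hx => lt_of_lt_of_le hx hst))

theorem mellinZeta_eq_mellin {N : ℕ} (A Ω : Set (EuclideanSpace ℝ (Fin N))) (s : ℂ) :
    mellinZeta N A Ω s = mellin (fun t => (tubeVol N A Ω t : ℂ)) (s - N) := rfl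

/-- The behaviour of the Mellin zeta function of a Minkowski measurable drum upon horizontal
approach to the critical line. -/
theorem tendsto_mul_mellinZeta {N : ℕ} {A Ω : Set (EuclideanSpace ℝ (Fin N))} {D M : ℝ}
    (hΩ : volume Ω < ⊤) (hDN : D < N) (hM : MinkMeasurable N A Ω D M) (τ : ℝ) :
    Tendsto (fun x : ℝ => (x : ℂ) * mellinZeta N A Ω (x + (D + τ * I))) (𝓝[>] 0)
      (𝓝 (if τ = 0 then (M : ℂ) else 0)) := by
  have hloc : LocallyIntegrableOn (fun t => (tubeVol N A Ω t : ℂ)) (Ioi 0) := by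
    refine LocallyIntegrable.locallyIntegrableOn (fun x => ?_) _
    obtain ⟨u, hu, hint⟩ := (monotone_tubeVol (A := A) hΩ).locallyIntegrable (μ := volume) x
    exact ⟨u, hu, hint.ofReal⟩
  have hb : ∀ t : ℝ, 0 < t → |tubeVol N A Ω t| ≤ (volume Ω).toReal := fun t _ => by
    rw [abs_of_nonneg (show 0 ≤ tubeVol N A Ω t from ENNReal.toReal_nonneg)]
    exact tubeVol_le hΩ t
  refine (tendsto_mul_mellin_of_tendsto_div_rpow (sub_pos.2 hDN) τ hloc hb hM.2).congr fun x => ?_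
  rw [mellinZeta_eq_mellin]
  congr 2
  push_cast
  ring

/-- A meromorphic extension `F` of the Mellin zeta function of a Minkowski measurable drum
satisfies `(s - ω) F(s) → M` at `ω = D`, and `(s - ω) F(s) → 0` at any other point `ω` of the
critical line. -/
theorem tendsto_sub_mul_of_minkMeasurable {N : ℕ} {A Ω : Set (EuclideanSpace ℝ (Fin N))}
    {D M : ℝ} {U : Set ℂ} {F : ℂ → ℂ} (hΩ : volume Ω < ⊤) (hDN : D < N)
    (hM : MinkMeasurable N A Ω D M) (hU : IsOpen U) (hF : MeromorphicOn F U)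
    (hFzeta : ∀ s ∈ U, D < s.re → s.re < N → F s = mellinZeta N A Ω s)
    (τ : ℝ) (hτ : (D : ℂ) + τ * I ∈ U) :
    Tendsto (fun s => (s - (D + τ * I)) * F s) (𝓝[≠] ((D : ℂ) + τ * I))
      (𝓝 (if τ = 0 then (M : ℂ) else 0)) := by
  set ω : ℂ := (D : ℂ) + τ * I with hω
  have hray : Tendsto (fun x : ℝ => (x : ℂ) + ω) (𝓝[>] 0) (𝓝[≠] ω) := by
    refine tendsto_nhdsWithin_iff.2 ⟨?_, ?_⟩
    · have : ContinuousAt (fun x : ℝ => (x : ℂ) + ω) 0 := by fun_prop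
      simpa using this.tendsto.mono_left nhdsWithin_le_nhds
    · filter_upwards [self_mem_nhdsWithin] with x hx
      simpa using ne_of_gt hx
  refine MeromorphicAt.tendsto_of_tendsto (l := map (fun x : ℝ => (x : ℂ) + ω) (𝓝[>] 0))
    (MeromorphicAt.mul (by fun_prop) (hF ω hτ)) hray ?_
  rw [tendsto_map'_iff]
  refine (tendsto_mul_mellinZeta hΩ hDN hM τ).congr' ?_
  filter_upwards [Ioo_mem_nhdsGT (sub_pos.2 hDN),
    (hray.mono_right nhdsWithin_le_nhds).eventually (hU.mem_nhds hτ)] with x hx hxU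
  have hre : ((x : ℂ) + ω).re = x + D := by simp [hω]
  have := hFzeta _ hxU (by rw [hre]; linarith [hx.1]) (by rw [hre]; linarith [hx.2])
  rw [Function.comp_apply, this, add_sub_cancel_right]

/-- necessary condition for Minkowski measurability.
Let `(A,Ω)` be an RFD in `ℝ^N` with `D := dim_B(A,Ω)`, `D < N`, which is Minkowski
measurable.  Let `S` be a screen with `sup S < D`, `U` an open connected neighborhood
of the window `W`, and `F` a meromorphic extension of `ζ^𝔐_{A,Ω}` to `U` satisfying
(L1)–(L2) with some exponent `κ`, where the constant `c` in (L1) lies in `(D,N)`.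
Assume the screen passes strictly to the right of all poles of `F` with real part `< D`.
Then `D` is the only pole of `F` on the critical line `{Re s = D}`, and it is simple. -/
theorem statement15
    (N : ℕ) (A Ω : Set (EuclideanSpace ℝ (Fin N))) (D : ℝ)
    (S : ℝ → ℝ) (U : Set ℂ) (F : ℂ → ℂ) (κ c C : ℝ) (T : ℤ → ℝ)
    (hRFD : IsRFD N A Ω) (hD : IsMinkDim N A Ω D) (hDN : D < N)
    (hMM : ∃ M : ℝ, MinkMeasurable N A Ω D M)
    (hscreen : IsScreen S D) (hSbdd : BddAbove (Set.range S))
    (hSlt : sSup (Set.range S) < D)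
    (hU : IsOpen U) (hUconn : IsPreconnected U) (hWU : window S ⊆ U)
    (hF : MeromorphicOn F U)
    (hFzeta : ∀ s ∈ U, D < s.re → s.re < N → F s = mellinZeta N A Ω s)
    (hcD : D < c) (hcN : c < N)
    (hlang : LanguidWith F S κ c C T)
    (hpoles : ∀ ω ∈ U, IsPoleAt F ω → ω.re < D → ω.re < S ω.im) :
    (∃ r : ℂ, r ≠ 0 ∧
      Tendsto (fun s : ℂ => (s - (D : ℂ)) * F s)
        (nhdsWithin (D : ℂ) {(D : ℂ)}ᶜ) (nhds r)) ∧
    ∀ ω ∈ U, ω.re = D → IsPoleAt F ω → ω = (D : ℂ) := by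
  obtain ⟨M, hM⟩ := hMM
  have hΩ : volume Ω < ⊤ := hRFD.2.2.1
  have hline : ∀ ω : ℂ, ω.re = D → ω ∈ U := fun ω hω =>
    hWU (show S ω.im ≤ ω.re from hω ▸ hscreen.2.2 ω.im)
  have key := tendsto_sub_mul_of_minkMeasurable hΩ hDN hM hU hF hFzeta
  refine ⟨⟨M, ofReal_ne_zero.2 hM.1.ne', ?_⟩, fun ω hωU hω hp => ?_⟩
  · simpa using key 0 (hline _ (by simp))
  · have hωe : ω = (D : ℂ) + ω.im * I := by rw [← hω, re_add_im]
    by_contra hne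
    have him : ω.im ≠ 0 := fun h0 => hne (by rw [hωe, h0]; simp)
    have := key ω.im (hωe ▸ hωU)
    rw [if_neg him, ← hωe] at this
    exact not_isPoleAt_of_tendsto_zero (hF ω hωU) this hp

end
end
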